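/- Let n ≥ 2, let d be a decoration of [n], and let a_j ∈ A_{d(j)} for j = 1, …, n. If a_j = 1_A for some j, then k_ε(a_1, …, a_n) = 0. -/

import Mathlib

/-!
Common setup: ε-noncrossing partitions (Ebrahimi-Fard–Patras–Speicher).

A partition of `[n]` is encoded as a `Setoid (Fin n)` (blocks = equivalence
classes).  A decoration is a map `d : Fin n → I`, and `ε : I → I → Bool` is a
symmetric family of values in `{0,1}` (with `true` playing the role of `1`).
-/

namespace EpsNC

open scoped Classical

variable {I : Type*}

/-- The partition `σ(Γ)`: blocks are the images under `σ` of the blocks of `Γ`. -/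
def permSetoid {n : ℕ} (σ : Equiv.Perm (Fin n)) (Γ : Setoid (Fin n)) : Setoid (Fin n) :=
  Setoid.comap (⇑σ⁻¹) Γ

/-- The decoration `σ(d)`, `σ(d)(i) = d(σ⁻¹(i))`. -/
def permDec {n : ℕ} (σ : Equiv.Perm (Fin n)) (d : Fin n → I) : Fin n → I :=
  d ∘ ⇑σ⁻¹

/-- The adjacent transposition `(i, j)` with `j = i + 1` is an allowed move for the
`d`-decorated partition `Γ` if `ε_{d(i)d(j)} = 1` and either `d(i) ≠ d(j)`, or
`d(i) = d(j)` and `i`, `j` lie in different blocks of `Γ`. -/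
def IsAllowedMove {n : ℕ} (ε : I → I → Bool) (d : Fin n → I) (Γ : Setoid (Fin n))
    (i j : Fin n) : Prop :=
  (i : ℕ) + 1 = (j : ℕ) ∧ ε (d i) (d j) = true ∧ (d i ≠ d j ∨ ¬ Γ i j)

/-- `σ` is an allowed permutation of the `d`-decorated partition `Γ` if it is a product
`τ_{i_k} ⋯ τ_{i_1}` of adjacent transpositions, each being an allowed move for the
(decorated) partition obtained by applying the previous ones. -/
inductive AllowedPerm {n : ℕ} (ε : I → I → Bool) (d : Fin n → I) (Γ : Setoid (Fin n)) :
    Equiv.Perm (Fin n) → Prop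
  | one : AllowedPerm ε d Γ 1
  | step {σ : Equiv.Perm (Fin n)} (i j : Fin n) :
      AllowedPerm ε d Γ σ →
      IsAllowedMove ε (permDec σ d) (permSetoid σ Γ) i j →
      AllowedPerm ε d Γ (Equiv.swap i j * σ)

/-- Standardization of the restriction of a map on `Fin n` to a subset `S`,
via the unique order isomorphism `Fin S.card ≃o S`. -/
noncomputable def restrictFun {n : ℕ} {α : Type*} (f : Fin n → α) (S : Finset (Fin n)) :
    Fin S.card → α :=
  fun k => f (S.orderIsoOfFin rfl k).1

/-- Standardization of the restriction of a partition of `Fin n` to a subset `S`,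
via the unique order isomorphism `Fin S.card ≃o S` (blocks are the nonempty
intersections of blocks with `S`, transported to `Fin S.card`). -/
noncomputable def restrictSetoid {n : ℕ} (Γ : Setoid (Fin n)) (S : Finset (Fin n)) :
    Setoid (Fin S.card) :=
  Setoid.comap (fun k => (S.orderIsoOfFin rfl k).1) Γ

/-- The block of the partition `Γ` containing `b`. -/
noncomputable def blockOf {n : ℕ} (Γ : Setoid (Fin n)) (b : Fin n) : Finset (Fin n) :=
  Finset.univ.filter (fun x => Γ b x)

/-- A subset of `Fin n` is an interval of consecutive integers iff it is order-connected. -/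
def IsIntervalBlock {n : ℕ} (S : Finset (Fin n)) : Prop :=
  ∀ ⦃x y z : Fin n⦄, x ∈ S → z ∈ S → x ≤ y → y ≤ z → y ∈ S

/-- A `d`-decorated partition `Γ` of `[n]` is ε-noncrossing if it can be reduced to the
empty partition by a finite sequence of reductions: a reduction consists of an allowed
permutation `σ` of `Γ` together with a block of `σ(Γ)` which is an interval of
consecutive integers; it deletes that block and standardizes the result. -/
inductive IsEpsNC (ε : I → I → Bool) : {n : ℕ} → (Fin n → I) → Setoid (Fin n) → Prop
  | empty (d : Fin 0 → I) (Γ : Setoid (Fin 0)) : IsEpsNC ε d Γ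
  | reduce {n : ℕ} {d : Fin n → I} {Γ : Setoid (Fin n)}
      (σ : Equiv.Perm (Fin n)) (b : Fin n)
      (hσ : AllowedPerm ε d Γ σ)
      (hint : IsIntervalBlock (blockOf (permSetoid σ Γ) b))
      (hrec : IsEpsNC ε
        (restrictFun (permDec σ d) (blockOf (permSetoid σ Γ) b)ᶜ)
        (restrictSetoid (permSetoid σ Γ) (blockOf (permSetoid σ Γ) b)ᶜ)) :
      IsEpsNC ε d Γ

/-- A partition of `[n]` is noncrossing if there are no `i < j < k < l` with `i, k` in
one block and `j, l` in a different block. -/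
def IsNoncrossing {n : ℕ} (Γ : Setoid (Fin n)) : Prop :=
  ∀ ⦃i j k l : Fin n⦄, i < j → j < k → k < l → Γ i k → Γ j l → Γ i j

/-- The set of blocks of a partition, as finsets. -/
noncomputable def blocksSet {n : ℕ} (Γ : Setoid (Fin n)) : Set (Finset (Fin n)) :=
  {B | ∃ b : Fin n, B = blockOf Γ b}

/-- `k_ε^Γ(a₁, …, aₙ)`: the product over the blocks `Γ_j = {x₁ < … < x_m}` of `Γ` of the
cumulants `κ(a_{x₁}, …, a_{x_m})` (with the corresponding decorations). -/
noncomputable def cumPart {K A : Type*} [Field K] {n : ℕ}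
    (κ : (m : ℕ) → (Fin m → I) → (Fin m → A) → K)
    (d : Fin n → I) (Γ : Setoid (Fin n)) (a : Fin n → A) : K :=
  ∏ᶠ B ∈ blocksSet Γ, κ B.card (restrictFun d B) (restrictFun a B)

/-- `φ^Γ(a₁, …, aₙ)`: the product over the blocks `Γ_j = {x₁ < … < x_m}` of `Γ` of the
moments `φ(a_{x₁} ⋯ a_{x_m})`. -/
noncomputable def phiPart {K A : Type*} [Field K] [Ring A] [Algebra K A] {n : ℕ}
    (φ : A →ₗ[K] K) (Γ : Setoid (Fin n)) (a : Fin n → A) : K :=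
  ∏ᶠ B ∈ blocksSet Γ, φ (List.ofFn (restrictFun a B)).prod

/-- The set of setoids on a finite type is finite (needed so that the sums over sets of
ε-noncrossing partitions below, taken with `∑ᶠ`, are honest finite sums). -/
instance {n : ℕ} : Finite (Setoid (Fin n)) :=
  Finite.of_injective (fun Γ : Setoid (Fin n) => ⇑Γ)
    (fun _ _ h => Setoid.ext fun x y => iff_of_eq (congrFun (congrFun h x) y))

/-- `κ` is the family of ε-cumulants of the noncommutative probability space `(A, φ)`
with distinguished subalgebras `(As i)_{i ∈ I}`: for every `n`, every decoration
`d : Fin n → I` and every tuple `a` with `a j ∈ As (d j)`, the moment-cumulant relation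
`φ(a₁ ⋯ aₙ) = Σ_{Γ ∈ P^{d,ε}_n} k_ε^Γ(a)` holds.  (This relation determines `κ`
uniquely on such tuples.) -/
def CumulantFamily {K A : Type*} [Field K] [Ring A] [Algebra K A]
    (ε : I → I → Bool) (φ : A →ₗ[K] K) (As : I → Subalgebra K A)
    (κ : (m : ℕ) → (Fin m → I) → (Fin m → A) → K) : Prop :=
  ∀ (m : ℕ) (d : Fin m → I) (a : Fin m → A), (∀ j, a j ∈ As (d j)) →
    φ (List.ofFn a).prod = ∑ᶠ Γ ∈ {Γ : Setoid (Fin m) | IsEpsNC ε d Γ}, cumPart κ d Γ a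

/-- The tuple `d = (d 1, …, d n)` lies in `I_n^ε`: whenever `d k = d l` for `k < l`,
there is `k < p < l` with `d p ≠ d k` and `ε_{d(p)d(k)} = 0`. -/
def MemIeps {n : ℕ} (ε : I → I → Bool) (d : Fin n → I) : Prop :=
  ∀ k l : Fin n, k < l → d k = d l →
    ∃ p : Fin n, k < p ∧ p < l ∧ d p ≠ d k ∧ ε (d p) (d k) = false

/-- The subalgebras `(As i)_{i ∈ I}` are ε-independent in `(A, φ)`. -/
def EpsIndependent {K A : Type*} [Field K] [Ring A] [Algebra K A]
    (ε : I → I → Bool) (φ : A →ₗ[K] K) (As : I → Subalgebra K A) : Prop :=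
  (∀ i j : I, i ≠ j → ε i j = true →
    ∀ a ∈ As i, ∀ b ∈ As j, a * b = b * a) ∧
  (∀ (n : ℕ) (d : Fin n → I) (a : Fin n → A), MemIeps ε d →
    (∀ k, a k ∈ As (d k)) → (∀ k, φ (a k) = 0) → φ (List.ofFn a).prod = 0)

/-- The join of two partitions in the lattice `P^{d,ε}_n` of ε-noncrossing partitions:
the finest ε-noncrossing partition coarser than both (computed as the meet, in the full
partition lattice, of all ε-noncrossing upper bounds). -/
noncomputable def epsJoin {n : ℕ} (ε : I → I → Bool) (d : Fin n → I)
    (Φ Ψ : Setoid (Fin n)) : Setoid (Fin n) :=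
  sInf {Θ : Setoid (Fin n) | IsEpsNC ε d Θ ∧ Φ ≤ Θ ∧ Ψ ≤ Θ}

theorem restrictFun_eq_comp {n : ℕ} {α : Type*} (f : Fin n → α) (S : Finset (Fin n)) :
    restrictFun f S = f ∘ S.orderEmbOfFin rfl := rfl

theorem restrictSetoid_eq_comap {n : ℕ} (Γ : Setoid (Fin n)) (S : Finset (Fin n)) :
    restrictSetoid Γ S = Γ.comap (S.orderEmbOfFin rfl) := rfl

theorem mem_blockOf {n : ℕ} {Γ : Setoid (Fin n)} {b x : Fin n} : x ∈ blockOf Γ b ↔ Γ b x := by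
  simp [blockOf]

theorem mem_blocksSet {n : ℕ} {Γ : Setoid (Fin n)} {B : Finset (Fin n)} :
    B ∈ blocksSet Γ ↔ ∃ b, B = blockOf Γ b := Iff.rfl

theorem exists_strictMono_comp_eq {m k n : ℕ} {f : Fin k → Fin n} {g : Fin m → Fin n}
    (hf : StrictMono f) (hg : StrictMono g) (h : ∀ x, g x ∈ Set.range f) :
    ∃ p : Fin m → Fin k, StrictMono p ∧ f ∘ p = g := by
  choose p hp using h
  refine ⟨p, fun x y hxy => ?_, funext hp⟩
  rw [← hf.lt_iff_lt, hp, hp]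
  exact hg hxy

theorem succ_of_apply_succ_of_strictMono {m n : ℕ} {g : Fin m → Fin n} (hg : StrictMono g)
    {x y : Fin m} (h : (g x : ℕ) + 1 = g y) : (x : ℕ) + 1 = y := by
  have hxy : x < y := by
    rw [← hg.lt_iff_lt, Fin.lt_def]
    omega
  by_contra hne
  have hlt : (x : ℕ) + 1 < y := by
    rw [Fin.lt_def] at hxy
    omega
  let z : Fin m := ⟨x + 1, by omega⟩
  have h₁ : g x < g z := hg (Fin.lt_def.2 (Nat.lt_succ_self _))
  have h₂ : g z < g y := hg (Fin.lt_def.2 hlt)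
  rw [Fin.lt_def] at h₁ h₂
  omega

theorem strictMono_swap_comp {m n : ℕ} {g : Fin m → Fin n} (hg : StrictMono g) {i j : Fin n}
    (hij : (i : ℕ) + 1 = j) (h : ¬ (i ∈ Set.range g ∧ j ∈ Set.range g)) :
    StrictMono (Equiv.swap i j ∘ g) := by
  intro x y hxy
  have hlt := hg hxy
  have hne : ¬ (g x = i ∧ g y = j) := fun hc => h ⟨⟨x, hc.1⟩, ⟨y, hc.2⟩⟩
  simp only [Function.comp_apply, Equiv.swap_apply_def]
  simp only [Fin.lt_def, Fin.ext_iff] at hlt hne ⊢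
  split_ifs <;> omega

theorem comp_inv_eq_of_comp_eq {m n : ℕ} {f g : Fin m → Fin n} {σ : Equiv.Perm (Fin n)}
    {τ : Equiv.Perm (Fin m)} (h : g ∘ τ = σ ∘ f) (x : Fin m) : f (τ⁻¹ x) = σ⁻¹ (g x) := by
  have := congrFun h (τ⁻¹ x)
  rw [Equiv.Perm.eq_inv_iff_eq]
  simpa using this.symm

theorem permDec_comp {m n : ℕ} {f g : Fin m → Fin n} {σ : Equiv.Perm (Fin n)}
    {τ : Equiv.Perm (Fin m)} (h : g ∘ τ = σ ∘ f) (d : Fin n → I) :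
    permDec τ (d ∘ f) = permDec σ d ∘ g :=
  funext fun x => congrArg d (comp_inv_eq_of_comp_eq h x)

theorem permSetoid_comap {m n : ℕ} {f g : Fin m → Fin n} {σ : Equiv.Perm (Fin n)}
    {τ : Equiv.Perm (Fin m)} (h : g ∘ τ = σ ∘ f) (Γ : Setoid (Fin n)) :
    permSetoid τ (Γ.comap f) = (permSetoid σ Γ).comap g := by
  ext x y
  change Γ (f (τ⁻¹ x)) (f (τ⁻¹ y)) ↔ Γ (σ⁻¹ (g x)) (σ⁻¹ (g y))
  rw [comp_inv_eq_of_comp_eq h, comp_inv_eq_of_comp_eq h]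

theorem AllowedPerm.comap {ε : I → I → Bool} {m n : ℕ} {d : Fin n → I} {Γ : Setoid (Fin n)}
    {σ : Equiv.Perm (Fin n)} (hσ : AllowedPerm ε d Γ σ) {f : Fin m → Fin n} (hf : StrictMono f) :
    ∃ (g : Fin m → Fin n) (τ : Equiv.Perm (Fin m)), StrictMono g ∧ g ∘ τ = σ ∘ f ∧
      AllowedPerm ε (d ∘ f) (Γ.comap f) τ := by
  induction hσ with
  | one => exact ⟨f, 1, hf, rfl, .one⟩
  | @step σ i j _ hmove ih =>
    obtain ⟨g, τ, hg, hgτ, hτ⟩ := ih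
    by_cases hr : i ∈ Set.range g ∧ j ∈ Set.range g
    · obtain ⟨⟨x, rfl⟩, y, rfl⟩ := hr
      refine ⟨g, Equiv.swap x y * τ, hg, ?_, hτ.step x y ?_⟩
      · ext z
        have := congrFun hgτ z
        simp only [Function.comp_apply] at this
        simp only [Function.comp_apply, Equiv.Perm.mul_apply, ← this, hg.injective.swap_apply]
      · rw [permDec_comp hgτ, permSetoid_comap hgτ]
        exact ⟨succ_of_apply_succ_of_strictMono hg hmove.1, hmove.2⟩
    · refine ⟨Equiv.swap i j ∘ g, τ, strictMono_swap_comp hg hmove.1 hr, ?_, hτ⟩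
      rw [Function.comp_assoc, hgτ]
      rfl

theorem AllowedPerm.mul {ε : I → I → Bool} {n : ℕ} {d : Fin n → I} {Γ : Setoid (Fin n)}
    {σ τ : Equiv.Perm (Fin n)} (hσ : AllowedPerm ε d Γ σ)
    (hτ : AllowedPerm ε (permDec σ d) (permSetoid σ Γ) τ) : AllowedPerm ε d Γ (τ * σ) := by
  induction hτ with
  | one => simpa using hσ
  | step i j _ hmove ih =>
    rw [mul_assoc]
    exact ih.step i j hmove

theorem IsEpsNC.of_perm {ε : I → I → Bool} {n : ℕ} {d : Fin n → I} {Γ : Setoid (Fin n)}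
    {σ : Equiv.Perm (Fin n)} (hσ : AllowedPerm ε d Γ σ)
    (h : IsEpsNC ε (permDec σ d) (permSetoid σ Γ)) : IsEpsNC ε d Γ := by
  generalize hd : permDec σ d = d' at h
  generalize hΓ : permSetoid σ Γ = Γ' at h
  cases h with
  | empty => exact .empty _ _
  | reduce τ b hτ hint hrec =>
    subst hd hΓ
    refine .reduce (τ * σ) b (hσ.mul hτ) ?_ ?_
    · exact hint
    · exact hrec

theorem isEpsNC_of_eq_zero (ε : I → I → Bool) {n : ℕ} (hn : n = 0) (d : Fin n → I)
    (Γ : Setoid (Fin n)) : IsEpsNC ε d Γ := by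
  subst hn
  exact .empty d Γ

/-- Restricting an ε-noncrossing partition to a subset keeps it ε-noncrossing. -/
theorem IsEpsNC.comap {ε : I → I → Bool} {n : ℕ} {d : Fin n → I} {Γ : Setoid (Fin n)}
    (h : IsEpsNC ε d Γ) {m : ℕ} {f : Fin m → Fin n} (hf : StrictMono f) :
    IsEpsNC ε (d ∘ f) (Γ.comap f) := by
  induction h generalizing m with
  | empty d Γ =>
    refine isEpsNC_of_eq_zero ε ?_ _ _
    by_contra hm
    exact (f ⟨0, Nat.pos_of_ne_zero hm⟩).elim0
  | @reduce n d Γ σ b hσ hint _ ih =>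
    obtain ⟨g, τ, hg, hgτ, hτ⟩ := hσ.comap hf
    by_cases hb : ∃ c, permSetoid σ Γ b (g c)
    · obtain ⟨c, hc⟩ := hb
      have hblock : ∀ x, x ∈ blockOf ((permSetoid σ Γ).comap g) c ↔
          g x ∈ blockOf (permSetoid σ Γ) b := fun x => by
        rw [mem_blockOf, mem_blockOf, Setoid.comap_rel]
        exact ⟨Setoid.trans' _ hc, Setoid.trans' _ (Setoid.symm' _ hc)⟩
      refine .reduce τ c hτ ?_ ?_
      · rw [permSetoid_comap hgτ]
        intro x y z hx hz hxy hyz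
        rw [hblock] at hx hz ⊢
        exact hint hx hz (hg.monotone hxy) (hg.monotone hyz)
      · rw [permSetoid_comap hgτ, permDec_comp hgτ]
        set B := blockOf ((permSetoid σ Γ).comap g) c
        obtain ⟨p, hp, hpg⟩ := exists_strictMono_comp_eq
          ((blockOf (permSetoid σ Γ) b)ᶜ.orderEmbOfFin rfl).strictMono
          (hg.comp (Bᶜ.orderEmbOfFin rfl).strictMono) (fun x => by
            rw [Finset.range_orderEmbOfFin, Finset.mem_coe, Finset.mem_compl,
              Function.comp_apply, ← hblock, ← Finset.mem_compl]
            exact Finset.orderEmbOfFin_mem _ _ _)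
        have := ih hp
        rw [restrictFun_eq_comp, restrictSetoid_eq_comap, Function.comp_assoc, hpg,
          ← Setoid.comap_comp, hpg] at this
        exact this
    · obtain ⟨p, hp, hpg⟩ := exists_strictMono_comp_eq
        ((blockOf (permSetoid σ Γ) b)ᶜ.orderEmbOfFin rfl).strictMono hg (fun x => by
          rw [Finset.range_orderEmbOfFin, Finset.mem_coe, Finset.mem_compl, mem_blockOf]
          exact fun hx => hb ⟨x, hx⟩)
      have := ih hp
      rw [restrictFun_eq_comp, restrictSetoid_eq_comap, Function.comp_assoc, hpg,
        ← Setoid.comap_comp, hpg, ← permDec_comp hgτ, ← permSetoid_comap hgτ] at this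
      exact this.of_perm hτ

theorem permSetoid_one {n : ℕ} (Γ : Setoid (Fin n)) : permSetoid 1 Γ = Γ := rfl

theorem permDec_one {n : ℕ} (d : Fin n → I) : permDec 1 d = d := rfl

theorem blockOf_top {n : ℕ} (b : Fin n) : blockOf (⊤ : Setoid (Fin n)) b = Finset.univ := by
  ext x
  simp [mem_blockOf]

theorem isEpsNC_top (ε : I → I → Bool) {n : ℕ} (d : Fin n → I) : IsEpsNC ε d ⊤ := by
  cases n with
  | zero => exact .empty _ _
  | succ n =>
    refine .reduce 1 0 .one ?_ (isEpsNC_of_eq_zero ε ?_ _ _)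
    · rw [permSetoid_one, blockOf_top]
      exact fun _ _ _ _ _ _ _ => Finset.mem_univ _
    · rw [permSetoid_one, blockOf_top]
      simp

/-- The partitions of `[n]` in which `{j}` is a block. -/
def singletonBlockSet {n : ℕ} (j : Fin n) : Set (Setoid (Fin n)) :=
  {Γ | ∀ x, Γ j x → x = j}

theorem blockOf_eq_singleton {n : ℕ} {j : Fin n} {Γ : Setoid (Fin n)}
    (h : Γ ∈ singletonBlockSet j) : blockOf Γ j = {j} := by
  ext x
  rw [mem_blockOf, Finset.mem_singleton]
  exact ⟨h x, fun hx => hx ▸ Setoid.refl' _ _⟩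

theorem isEpsNC_iff_comap_succAbove {ε : I → I → Bool} {n : ℕ} {d : Fin (n + 1) → I}
    {j : Fin (n + 1)} {Γ : Setoid (Fin (n + 1))} (h : Γ ∈ singletonBlockSet j) :
    IsEpsNC ε d Γ ↔ IsEpsNC ε (d ∘ j.succAbove) (Γ.comap j.succAbove) := by
  have hj := Fin.strictMono_succAbove j
  refine ⟨fun hΓ => hΓ.comap hj, fun hΓ => .reduce 1 j .one ?_ ?_⟩
  · rw [permSetoid_one, blockOf_eq_singleton h]
    intro x y z hx hz hxy hyz
    rw [Finset.mem_singleton] at *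
    subst hx hz
    exact le_antisymm hyz hxy
  · rw [permSetoid_one, permDec_one, blockOf_eq_singleton h, restrictFun_eq_comp,
      restrictSetoid_eq_comap]
    obtain ⟨p, hp, hpj⟩ := exists_strictMono_comp_eq hj
      (({j}ᶜ : Finset (Fin (n + 1))).orderEmbOfFin rfl).strictMono (fun x => by
        rw [Fin.range_succAbove]
        have := Finset.orderEmbOfFin_mem ({j}ᶜ : Finset (Fin (n + 1))) rfl x
        rwa [Finset.mem_compl, Finset.mem_singleton] at this)
    rw [← hpj, ← Function.comp_assoc, Setoid.comap_comp]
    exact hΓ.comap hp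

theorem comap_succAbove_injOn {n : ℕ} (j : Fin (n + 1)) :
    Set.InjOn (Setoid.comap j.succAbove) (singletonBlockSet j) := by
  have key : ∀ {Γ Δ : Setoid (Fin (n + 1))}, Γ ∈ singletonBlockSet j →
      Γ.comap j.succAbove = Δ.comap j.succAbove → Γ ≤ Δ := by
    intro Γ Δ hΓ h x y hxy
    rcases Fin.eq_self_or_eq_succAbove j x with rfl | ⟨x, rfl⟩
    · rw [hΓ y hxy]
    rcases Fin.eq_self_or_eq_succAbove j y with rfl | ⟨y, rfl⟩
    · rw [hΓ _ (Setoid.symm' _ hxy)]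
    exact (Setoid.ext_iff.1 h _ _).1 hxy
  exact fun Γ hΓ Δ hΔ h => le_antisymm (key hΓ h) (key hΔ h.symm)

theorem exists_comap_succAbove_eq {n : ℕ} (j : Fin (n + 1)) (Δ : Setoid (Fin n)) :
    ∃ Γ ∈ singletonBlockSet j, Γ.comap j.succAbove = Δ := by
  let F : Fin (n + 1) → Option (Quotient Δ) :=
    j.insertNth none fun x => some (Quotient.mk Δ x)
  refine ⟨Setoid.ker F, fun x hx => ?_, ?_⟩
  · rcases Fin.eq_self_or_eq_succAbove j x with rfl | ⟨x, rfl⟩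
    · rfl
    · simp [Setoid.ker_def, F] at hx
  · ext x y
    simp only [Setoid.comap_rel, Setoid.ker_def, F, Fin.insertNth_apply_succAbove,
      Option.some_inj]
    exact Quotient.eq

theorem apply_restrictFun {K A : Type*} (κ : (m : ℕ) → (Fin m → I) → (Fin m → A) → K)
    {m n : ℕ} (d : Fin n → I) (a : Fin n → A) {S : Finset (Fin n)} (hS : S.card = m)
    {g : Fin m → Fin n} (hg : StrictMono g) (hmem : ∀ x, g x ∈ S) :
    κ S.card (restrictFun d S) (restrictFun a S) = κ m (d ∘ g) (a ∘ g) := by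
  subst hS
  rw [Finset.orderEmbOfFin_unique rfl hmem hg, restrictFun_eq_comp, restrictFun_eq_comp]

theorem blocksSet_top {n : ℕ} [NeZero n] :
    blocksSet (⊤ : Setoid (Fin n)) = {Finset.univ} := by
  ext B
  simp [mem_blocksSet, blockOf_top]

theorem cumPart_top {K A : Type*} [Field K] (κ : (m : ℕ) → (Fin m → I) → (Fin m → A) → K)
    {n : ℕ} [NeZero n] (d : Fin n → I) (a : Fin n → A) : cumPart κ d ⊤ a = κ n d a := by
  rw [cumPart, blocksSet_top, finprod_mem_singleton,
    apply_restrictFun κ d a (by simp) strictMono_id (by simp)]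
  rfl

theorem blockOf_succAbove {n : ℕ} {j : Fin (n + 1)} {Γ : Setoid (Fin (n + 1))}
    (h : Γ ∈ singletonBlockSet j) (b : Fin n) :
    blockOf Γ (j.succAbove b) =
      (blockOf (Γ.comap j.succAbove) b).map j.succAboveEmb := by
  ext x
  rw [mem_blockOf, Finset.mem_map]
  simp only [mem_blockOf, Setoid.comap_rel, Fin.coe_succAboveEmb]
  refine ⟨fun hx => ?_, ?_⟩
  · rcases Fin.eq_self_or_eq_succAbove j x with rfl | ⟨x, rfl⟩
    · exact absurd (h _ (Setoid.symm' _ hx)) (Fin.succAbove_ne _ _)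
    · exact ⟨x, hx, rfl⟩
  · rintro ⟨x, hx, rfl⟩
    exact hx

theorem blocksSet_eq_insert {n : ℕ} {j : Fin (n + 1)} {Γ : Setoid (Fin (n + 1))}
    (h : Γ ∈ singletonBlockSet j) :
    blocksSet Γ = insert {j}
      (Finset.map j.succAboveEmb '' blocksSet (Γ.comap j.succAbove)) := by
  ext B
  rw [mem_blocksSet, Fin.exists_iff_succAbove j, blockOf_eq_singleton h]
  simp only [blockOf_succAbove h, Set.mem_insert_iff, Set.mem_image, mem_blocksSet]
  refine or_congr_right ⟨?_, ?_⟩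
  · rintro ⟨b, rfl⟩
    exact ⟨_, ⟨b, rfl⟩, rfl⟩
  · rintro ⟨_, ⟨b, rfl⟩, rfl⟩
    exact ⟨b, rfl⟩

theorem cumPart_eq_mul {K A : Type*} [Field K] (κ : (m : ℕ) → (Fin m → I) → (Fin m → A) → K)
    {n : ℕ} {j : Fin (n + 1)} {Γ : Setoid (Fin (n + 1))} (h : Γ ∈ singletonBlockSet j)
    (d : Fin (n + 1) → I) (a : Fin (n + 1) → A) :
    cumPart κ d Γ a = κ 1 (fun _ => d j) (fun _ => a j) *
      cumPart κ (d ∘ j.succAbove) (Γ.comap j.succAbove) (a ∘ j.succAbove) := by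
  rw [cumPart, blocksSet_eq_insert h, finprod_mem_insert _ _ (Set.toFinite _),
    finprod_mem_image (Finset.map_injective _).injOn, cumPart]
  · congr 1
    · exact apply_restrictFun κ d a (Finset.card_singleton j) (g := fun _ => j)
        (Subsingleton.strictMono _) (by simp)
    · refine finprod_mem_congr rfl fun B _ => ?_
      exact apply_restrictFun κ d a (Finset.card_map _) (g := j.succAbove ∘ B.orderEmbOfFin rfl)
        ((Fin.strictMono_succAbove j).comp (B.orderEmbOfFin rfl).strictMono) (fun x => by
          rw [Finset.mem_map]
          exact ⟨_, Finset.orderEmbOfFin_mem B rfl x, rfl⟩)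
  · rintro ⟨B, -, hB⟩
    have : j ∈ B.map j.succAboveEmb := hB ▸ Finset.mem_singleton_self j
    obtain ⟨x, -, hx⟩ := Finset.mem_map.1 this
    exact Fin.succAbove_ne j x hx

theorem prod_ofFn_eq_of_apply_eq_one {M : Type*} [Monoid M] {n : ℕ} (a : Fin (n + 1) → M)
    (j : Fin (n + 1)) (hj : a j = 1) :
    (List.ofFn a).prod = (List.ofFn (a ∘ j.succAbove)).prod := by
  induction n with
  | zero =>
    obtain rfl : j = 0 := Fin.fin_one_eq_zero j
    simp [hj]
  | succ n ih =>
    rw [List.ofFn_succ, List.prod_cons]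
    cases j using Fin.cases with
    | zero => simp [hj, Function.comp_def]
    | succ j =>
      rw [ih (fun i => a i.succ) j hj, List.ofFn_succ (f := a ∘ _), List.prod_cons]
      simp [Function.comp_def]

theorem CumulantFamily.apply_one {K A : Type*} [Field K] [Ring A] [Algebra K A]
    {ε : I → I → Bool} {φ : A →ₗ[K] K} {As : I → Subalgebra K A}
    {κ : (m : ℕ) → (Fin m → I) → (Fin m → A) → K} (hκ : CumulantFamily ε φ As κ)
    {i : I} {x : A} (hx : x ∈ As i) : κ 1 (fun _ => i) (fun _ => x) = φ x := by
  have h := hκ 1 (fun _ => i) (fun _ => x) fun _ => hx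
  have hset : {Γ : Setoid (Fin 1) | IsEpsNC ε (fun _ => i) Γ} = {⊤} := by
    ext Γ
    have hΓ : Γ = ⊤ := by
      ext x y
      simp [Subsingleton.elim x y]
    simpa [hΓ] using isEpsNC_top ε _
  rw [hset, finsum_mem_singleton, cumPart_top] at h
  simpa using h.symm

/-- The part of the moment-cumulant formula coming from partitions with `{j}` as a block. -/
theorem finsum_mem_singletonBlockSet {K A : Type*} [Field K] (ε : I → I → Bool)
    (κ : (m : ℕ) → (Fin m → I) → (Fin m → A) → K) {n : ℕ} (j : Fin (n + 1))
    (d : Fin (n + 1) → I) (a : Fin (n + 1) → A) :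
    ∑ᶠ Γ ∈ {Γ | IsEpsNC ε d Γ} ∩ singletonBlockSet j, cumPart κ d Γ a =
      κ 1 (fun _ => d j) (fun _ => a j) *
        ∑ᶠ Γ ∈ {Γ | IsEpsNC ε (d ∘ j.succAbove) Γ},
          cumPart κ (d ∘ j.succAbove) Γ (a ∘ j.succAbove) := by
  rw [mul_finsum_mem]
  refine finsum_mem_eq_of_bijOn (Setoid.comap j.succAbove) ⟨?_, ?_, ?_⟩ ?_
  · exact fun Γ hΓ => (isEpsNC_iff_comap_succAbove hΓ.2).1 hΓ.1
  · exact (comap_succAbove_injOn j).mono Set.inter_subset_right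
  · intro Δ hΔ
    obtain ⟨Γ, hΓ, rfl⟩ := exists_comap_succAbove_eq j Δ
    exact ⟨Γ, ⟨(isEpsNC_iff_comap_succAbove hΓ).2 hΔ, hΓ⟩, rfl⟩
  · exact fun Γ hΓ => cumPart_eq_mul κ hΓ.2 d a

theorem cumPart_eq_zero {K A : Type*} [Field K] {κ : (m : ℕ) → (Fin m → I) → (Fin m → A) → K}
    {n : ℕ} {d : Fin n → I} {Γ : Setoid (Fin n)} {a : Fin n → A} (b : Fin n)
    (h : κ (blockOf Γ b).card (restrictFun d (blockOf Γ b)) (restrictFun a (blockOf Γ b)) = 0) :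
    cumPart κ d Γ a = 0 := by
  rw [cumPart, finprod_mem_eq_finite_toFinset_prod _ (Set.toFinite _)]
  exact Finset.prod_eq_zero ((Set.Finite.mem_toFinset _).2 ⟨b, rfl⟩) h

/-- Let `n ≥ 2`, `d` a decoration of `[n]` and `a_j ∈ A_{d(j)}` for all
`j`.  If some `a_j` is the unit `1_A`, then `k_ε(a_1, …, a_n) = 0`. -/
theorem cumulant_eq_zero_of_unit {I K A : Type*} [Field K] [CharZero K]
    [Ring A] [Algebra K A]
    (ε : I → I → Bool) (hsym : ∀ i j : I, ε i j = ε j i)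
    (φ : A →ₗ[K] K) (hφ1 : φ 1 = 1) (As : I → Subalgebra K A)
    (κ : (m : ℕ) → (Fin m → I) → (Fin m → A) → K)
    (hκ : CumulantFamily ε φ As κ)
    {n : ℕ} (hn : 2 ≤ n) (d : Fin n → I) (a : Fin n → A)
    (ha : ∀ j, a j ∈ As (d j)) (j : Fin n) (hj : a j = 1) :
    κ n d a = 0 := by
  induction n using Nat.strong_induction_on with
  | _ n ih =>
  obtain ⟨n, rfl⟩ : ∃ m, n = m + 1 := ⟨n - 1, by omega⟩
  have hrest : ∀ Γ : Setoid (Fin (n + 1)), Γ ∉ singletonBlockSet j → Γ ≠ ⊤ →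
      cumPart κ d Γ a = 0 := by
    intro Γ hΓ htop
    have hjB : j ∈ blockOf Γ j := mem_blockOf.2 (Setoid.refl' _ _)
    have hcard_lt : (blockOf Γ j).card < n + 1 := by
      refine lt_of_not_ge fun hle => htop ?_
      have huniv : blockOf Γ j = Finset.univ :=
        Finset.eq_univ_of_card _ (le_antisymm (Finset.card_le_univ _) (by simpa using hle))
      have hj' : ∀ x, Γ j x := fun x => mem_blockOf.1 (huniv ▸ Finset.mem_univ x)
      exact Setoid.eq_top_iff.2 fun x y => Setoid.trans' _ (Setoid.symm' _ (hj' x)) (hj' y)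
    obtain ⟨x, hx, hxj⟩ : ∃ x, Γ j x ∧ x ≠ j := by
      simpa [singletonBlockSet] using hΓ
    have hcard : 2 ≤ (blockOf Γ j).card :=
      Finset.one_lt_card.2 ⟨x, mem_blockOf.2 hx, j, hjB, hxj⟩
    obtain ⟨k, hk⟩ : j ∈ Set.range ((blockOf Γ j).orderEmbOfFin rfl) := by
      rwa [Finset.range_orderEmbOfFin]
    refine cumPart_eq_zero j (ih _ hcard_lt hcard _ _ (fun _ => ha _) k ?_)
    rw [restrictFun_eq_comp, Function.comp_apply, hk, hj]
  have htop : (⊤ : Setoid (Fin (n + 1))) ∉ singletonBlockSet j := by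
    intro h
    have : Nontrivial (Fin (n + 1)) := Fin.nontrivial_iff_two_le.2 hn
    obtain ⟨x, hx⟩ := exists_ne j
    exact hx (h x trivial)
  have hmain := hκ (n + 1) d a ha
  have hinsert : ∑ᶠ Γ ∈ {Γ | IsEpsNC ε d Γ}, cumPart κ d Γ a =
      ∑ᶠ Γ ∈ insert ⊤ ({Γ | IsEpsNC ε d Γ} ∩ singletonBlockSet j), cumPart κ d Γ a := by
    refine finsum_mem_inter_support_eq' _ _ _ fun Γ hΓ => ⟨fun h => ?_, ?_⟩
    · by_contra hcon
      simp only [Set.mem_insert_iff, Set.mem_inter_iff, not_or, not_and] at hcon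
      exact hΓ (hrest Γ (hcon.2 h) hcon.1)
    · rintro (rfl | h)
      · exact isEpsNC_top ε d
      · exact h.1
  rw [hinsert, finsum_mem_insert _ (fun h => htop h.2) (Set.toFinite _), cumPart_top,
    finsum_mem_singletonBlockSet, hκ.apply_one (ha j), hj, hφ1, one_mul,
    ← hκ n (d ∘ j.succAbove) (a ∘ j.succAbove) (fun _ => ha _),
    prod_ofFn_eq_of_apply_eq_one a j hj] at hmain
  simpa using hmain

end EpsNC
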